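/- arXiv:1107.1383 — 5 statements merged into one kernel-verified Lean document; each statement's English description precedes it below -/
import Mathlib

section
/- (Composition Lemma) Let C_1 and C_2 be two disjoint sets of components over alphabet Σ, with Σ partitioned into Σ_12 (labels occurring in both C_1 and C_2), Σ_1 (labels occurring only in C_1), and Σ_2 (labels occurring only in C_2). Let P_1 ⊆ Σ × Σ_1 and P_2 ⊆ Σ × Σ_2 be priority sets, and consider the three systems S_1 = (C_1 ∪ {d_1}, Σ, P_1), S_2 = (C_2 ∪ {d_2}, Σ, P_2), and S_{1+2} = (C_1 ∪ C_2, Σ, P_1 ∪ P_2). Then L(S_{1+2}) ⊆ L(S_1) ∩ L(S_2). -/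
open scoped Classical

namespace BIP

/-- A transition of a component: source, guard, label, update, destination. -/
structure BTrans (A L V : Type) where
  src : L
  guard : (V → Bool) → Bool
  label : A
  update : V → (V → Bool) → Bool
  dst : L

/-- A component of a simple BIP system. -/
structure Component (A : Type) where
  Loc : Type
  Var : Type
  alph : Set A
  trans : Set (BTrans A Loc Var)
  initLoc : Loc
  initVal : Var → Bool

/-- A simple BIP system: an indexed family of components and a priority set. -/
structure System (A : Type) where
  ι : Type
  comp : ι → Component A
  prio : Set (A × A)

/-- The relation induced by a priority set is transitive and irreflexive. -/
def PrioOK {A : Type} (P : Set (A × A)) : Prop :=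
  (∀ a b c : A, (a, b) ∈ P → (b, c) ∈ P → (a, c) ∈ P) ∧ ∀ a : A, (a, a) ∉ P

/-- A configuration: a current location and valuation for each component. -/
def Config {A : Type} (S : System A) : Type :=
  ∀ i : S.ι, (S.comp i).Loc × ((S.comp i).Var → Bool)

/-- The initial configuration. -/
def initConfig {A : Type} (S : System A) : Config S :=
  fun i => ((S.comp i).initLoc, (S.comp i).initVal)

/-- Joint participation: every component whose alphabet contains `σ` has an
outgoing `σ`-transition from its current location whose guard holds. -/
def JointPart {A : Type} (S : System A) (σ : A) (c : Config S) : Prop :=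
  ∀ i, σ ∈ (S.comp i).alph →
    ∃ t ∈ (S.comp i).trans, t.label = σ ∧ t.src = (c i).1 ∧ t.guard (c i).2 = true

/-- An interaction is enabled if it satisfies joint participation and no
interaction of higher priority satisfies joint participation. -/
def Enabled {A : Type} (S : System A) (σ : A) (c : Config S) : Prop :=
  JointPart S σ c ∧ ∀ σ', (σ, σ') ∈ S.prio → ¬ JointPart S σ' c

/-- Executing an enabled interaction: every participating component moves along
one of its `σ`-transitions, all other components stutter. -/
def Step {A : Type} (S : System A) (σ : A) (c c' : Config S) : Prop :=
  Enabled S σ c ∧ ∀ i,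
    (σ ∈ (S.comp i).alph →
      ∃ t ∈ (S.comp i).trans, t.label = σ ∧ t.src = (c i).1 ∧ t.guard (c i).2 = true ∧
        (c' i).1 = t.dst ∧ (c' i).2 = fun v => t.update v (c i).2) ∧
    (σ ∉ (S.comp i).alph → c' i = c i)

/-- The set of configurations reachable from the initial configuration. -/
def Reach {A : Type} (S : System A) : Set (Config S) :=
  {c | Relation.ReflTransGen (fun x y => ∃ σ, Step S σ x y) (initConfig S) c}

/-- A run: a sequence of interactions executed from a configuration. -/
inductive Run {A : Type} (S : System A) : Config S → List A → Config S → Prop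
  | nil (c : Config S) : Run S c [] c
  | cons {c c' c'' : Config S} {σ : A} {w : List A} :
      Step S σ c c' → Run S c' w c'' → Run S c (σ :: w) c''

/-- The language of a system: interaction sequences executable from the
initial configuration. -/
def Lang {A : Type} (S : System A) : Set (List A) :=
  {w | ∃ c', Run S (initConfig S) w c'}

/-- A configuration is a deadlock if no interaction is enabled in it. -/
def Deadlock {A : Type} (S : System A) (c : Config S) : Prop :=
  ∀ σ, ¬ Enabled S σ c

/-- A system is deadlock-free if no reachable configuration is a deadlock. -/
def DeadlockFree {A : Type} (S : System A) : Prop :=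
  ∀ c ∈ Reach S, ¬ Deadlock S c

/-! ### ♯-abstraction -/

/-- The alphabet transformer: labels in the abstract alphabet `Φ` are replaced
by the fresh label `♯` (modelled as `none`), all other labels are kept. -/
noncomputable def alphaMap {A : Type} (Φ : Set A) (σ : A) : Option A :=
  if σ ∈ Φ then none else some σ

/-- Relabel a transition. -/
def BTrans.relabel {A B L V : Type} (f : A → B) (t : BTrans A L V) : BTrans B L V :=
  ⟨t.src, t.guard, f t.label, t.update, t.dst⟩

/-- Component-wise syntactic replacement of labels in `Φ` by `♯`. -/
noncomputable def absComp {A : Type} (Φ : Set A) (co : Component A) : Component (Option A) where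
  Loc := co.Loc
  Var := co.Var
  alph := alphaMap Φ '' co.alph
  trans := BTrans.relabel (alphaMap Φ) '' co.trans
  initLoc := co.initLoc
  initVal := co.initVal

/-- The ♯-abstract system of `S` w.r.t. the abstract alphabet `Φ`. -/
noncomputable def absSystem {A : Type} (Φ : Set A) (S : System A) : System (Option A) where
  ι := S.ι
  comp := fun i => absComp Φ (S.comp i)
  prio := (fun p : A × A => (alphaMap Φ p.1, alphaMap Φ p.2)) '' S.prio

/-- Joint participation in a ♯-abstract system: for `♯` (i.e. `none`) it only
requires *some* component to have an enabled `♯`-transition. -/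
def AbsJointPart {A : Type} (T : System (Option A)) (σ : Option A) (c : Config T) : Prop :=
  match σ with
  | some a => JointPart T (some a) c
  | none => ∃ i, none ∈ (T.comp i).alph ∧
      ∃ t ∈ (T.comp i).trans, t.label = none ∧ t.src = (c i).1 ∧ t.guard (c i).2 = true

/-- Enabledness in a ♯-abstract system. -/
def AbsEnabled {A : Type} (T : System (Option A)) (σ : Option A) (c : Config T) : Prop :=
  AbsJointPart T σ c ∧ ∀ σ', (σ, σ') ∈ T.prio → ¬ AbsJointPart T σ' c

/-- A component takes one of its enabled `♯`-transitions. -/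
def SharpMove {A : Type} (co : Component (Option A))
    (s s' : co.Loc × (co.Var → Bool)) : Prop :=
  ∃ t ∈ co.trans, t.label = none ∧ t.src = s.1 ∧ t.guard s.2 = true ∧
    s'.1 = t.dst ∧ s'.2 = fun v => t.update v s.2

/-- A step of a ♯-abstract system: labels `some a` keep the standard BIP
semantics; for `♯` every component with an enabled `♯`-transition may take
one such transition or stay, at least one component moves, and all other
components stutter (may-update semantics). -/
def AbsStep {A : Type} (T : System (Option A)) (σ : Option A) (c c' : Config T) : Prop :=
  match σ with
  | some a => AbsEnabled T (some a) c ∧ ∀ i,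
      (some a ∈ (T.comp i).alph →
        ∃ t ∈ (T.comp i).trans, t.label = some a ∧ t.src = (c i).1 ∧ t.guard (c i).2 = true ∧
          (c' i).1 = t.dst ∧ (c' i).2 = fun v => t.update v (c i).2) ∧
      (some a ∉ (T.comp i).alph → c' i = c i)
  | none => AbsEnabled T none c ∧
      (∀ i, c' i = c i ∨ (none ∈ (T.comp i).alph ∧ SharpMove (T.comp i) (c i) (c' i))) ∧
      (∃ i, none ∈ (T.comp i).alph ∧ SharpMove (T.comp i) (c i) (c' i))

/-- Configurations of a ♯-abstract system reachable from the initial one. -/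
def AbsReach {A : Type} (T : System (Option A)) : Set (Config T) :=
  {c | Relation.ReflTransGen (fun x y => ∃ σ, AbsStep T σ x y) (initConfig T) c}

/-- A configuration is ♯-deadlocked if no interaction `σ ∈ Σ \ Σ_Φ` is
enabled in it. -/
def SharpDeadlocked {A : Type} (Φ : Set A) (T : System (Option A)) (c : Config T) : Prop :=
  ∀ σ : A, σ ∉ Φ → ¬ AbsEnabled T (some σ) c

/-- A ♯-abstract system is ♯-deadlock-free if no reachable configuration is
♯-deadlocked. -/
def SharpDeadlockFree {A : Type} (Φ : Set A) (T : System (Option A)) : Prop :=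
  ∀ c ∈ AbsReach T, ¬ SharpDeadlocked Φ T c

/-! ### Stuttering components, occurring labels, component traces -/

/-- The stuttering component `d` with a single location and a self-loop
transition for every label in `Sl`. -/
def stutter {A : Type} (Sl : Set A) : Component A where
  Loc := Unit
  Var := Empty
  alph := Sl
  trans := (fun a => (⟨(), fun _ => true, a, fun v _ => v.elim, ()⟩ : BTrans A Unit Empty)) '' Sl
  initLoc := ()
  initVal := fun v => v.elim

/-- The set of labels occurring in a family of components. -/
def occ {A ι : Type} (C : ι → Component A) : Set A := ⋃ i, (C i).alph

/-- Traces of a standalone component: words labelling paths along transitions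
whose guards hold. -/
inductive CompTrace {A : Type} (co : Component A) :
    co.Loc → (co.Var → Bool) → List A → Prop
  | nil (l : co.Loc) (e : co.Var → Bool) : CompTrace co l e []
  | cons {l : co.Loc} {e : co.Var → Bool} {w : List A} (t : BTrans A co.Loc co.Var)
      (ht : t ∈ co.trans) (hsrc : t.src = l) (hg : t.guard e = true)
      (htail : CompTrace co t.dst (fun v => t.update v e) w) :
      CompTrace co l e (t.label :: w)

/-- The traces of a standalone component from its initial location. -/
def Traces {A : Type} (co : Component A) : Set (List A) :=
  {w | CompTrace co co.initLoc co.initVal w}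

end BIP

open BIP

/-- A functional simulation yields language inclusion. -/
theorem lang_subset_of_step_map {A : Type} {S T : System A} (f : Config S → Config T)
    (hinit : f (initConfig S) = initConfig T)
    (hstep : ∀ σ c c', Step S σ c c' → Step T σ (f c) (f c')) : Lang S ⊆ Lang T := by
  rintro w ⟨c', hrun⟩
  have run_map : ∀ {c w c'}, Run S c w c' → Run T (f c) w (f c') := by
    intro c w c' h
    induction h with
    | nil c => exact Run.nil _
    | cons hs _ ih => exact Run.cons (hstep _ _ _ hs) ih
  exact ⟨f c', hinit ▸ run_map hrun⟩

/-- Reindexing the components along a surjection does not lose words. -/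
theorem lang_subset_reindex {A ι κ : Type} (C : ι → Component A) (P : Set (A × A)) (e : κ → ι)
    (he : Function.Surjective e) :
    Lang (⟨ι, C, P⟩ : System A) ⊆ Lang (⟨κ, C ∘ e, P⟩ : System A) := by
  refine lang_subset_of_step_map (T := ⟨κ, C ∘ e, P⟩) (fun c k => c (e k)) rfl ?_
  rintro σ c c' ⟨⟨hjoint, hprio⟩, hmove⟩
  refine ⟨⟨fun k => hjoint (e k), fun σ' hσ' h => hprio σ' hσ' fun i => ?_⟩, fun k => hmove (e k)⟩
  obtain ⟨k, rfl⟩ := he i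
  exact h k

/-- Replacing the components `C₂` by a stuttering component over any label set, and dropping
priorities, preserves every word, provided that the remaining priorities only favour labels which
do not occur in `C₂`. -/
theorem lang_subset_stutter_right {A ι₁ ι₂ : Type} (C₁ : ι₁ → Component A)
    (C₂ : ι₂ → Component A) {P Q : Set (A × A)} (Sl : Set A) (hQP : Q ⊆ P)
    (hQ : ∀ p ∈ Q, p.2 ∉ occ C₂) :
    Lang (⟨ι₁ ⊕ ι₂, Sum.elim C₁ C₂, P⟩ : System A) ⊆
      Lang (⟨ι₁ ⊕ Unit, Sum.elim C₁ fun _ => stutter Sl, Q⟩ : System A) := by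
  refine lang_subset_of_step_map
    (S := ⟨ι₁ ⊕ ι₂, Sum.elim C₁ C₂, P⟩)
    (T := ⟨ι₁ ⊕ Unit, Sum.elim C₁ fun _ => stutter Sl, Q⟩)
    (fun c i => match i with
      | .inl i => c (.inl i)
      | .inr _ => initConfig ⟨Unit, fun _ => stutter Sl, Q⟩ ()) ?_ ?_
  · funext i
    rcases i with i | u <;> rfl
  rintro σ c c' ⟨⟨hjoint, hprio⟩, hmove⟩
  refine ⟨⟨?_, ?_⟩, ?_⟩
  · rintro (i | u) hσ
    · exact hjoint (.inl i) hσ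
    · exact ⟨_, ⟨σ, hσ, rfl⟩, rfl, rfl, rfl⟩
  · intro σ' hσ' h
    refine hprio σ' (hQP hσ') ?_
    rintro (i | i) hi
    · exact h (.inl i) hi
    · exact absurd (Set.mem_iUnion.2 ⟨i, hi⟩) (hQ _ hσ')
  · rintro (i | u)
    · exact hmove (.inl i)
    · exact ⟨fun hσ => ⟨_, ⟨σ, hσ, rfl⟩, rfl, rfl, rfl, rfl, funext fun v => v.elim⟩, fun _ => rfl⟩

/-- Swapping two families of components does not lose words. -/
theorem lang_subset_swap {A ι₁ ι₂ : Type} (C₁ : ι₁ → Component A) (C₂ : ι₂ → Component A)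
    (P : Set (A × A)) :
    Lang (⟨ι₁ ⊕ ι₂, Sum.elim C₁ C₂, P⟩ : System A) ⊆
      Lang (⟨ι₂ ⊕ ι₁, Sum.elim C₂ C₁, P⟩ : System A) := by
  have h : Sum.elim C₁ C₂ ∘ Sum.swap = Sum.elim C₂ C₁ := by
    funext i
    rcases i with i | i <;> rfl
  exact h ▸ lang_subset_reindex (Sum.elim C₁ C₂) P Sum.swap Sum.swap_rightInverse.surjective

/-- Composition Lemma: for disjoint sets of components `C₁`, `C₂`
over `Σ` (partitioned into shared labels `Σ₁₂ = occ C₁ ∩ occ C₂` and local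
labels `Σ₁ = occ C₁ \ occ C₂`, `Σ₂ = occ C₂ \ occ C₁`) and priority sets
`P₁ ⊆ Σ × Σ₁`, `P₂ ⊆ Σ × Σ₂`, we have
`L(S_{1+2}) ⊆ L(S₁) ∩ L(S₂)` where `S₁ = (C₁ ∪ {d₁}, Σ, P₁)`,
`S₂ = (C₂ ∪ {d₂}, Σ, P₂)` and `S_{1+2} = (C₁ ∪ C₂, Σ, P₁ ∪ P₂)`. -/
theorem composition_lemma {A : Type} [Fintype A] {ι₁ ι₂ : Type} [Finite ι₁] [Finite ι₂]
    (C₁ : ι₁ → Component A) (C₂ : ι₂ → Component A) (P₁ P₂ : Set (A × A))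
    (hcov : occ C₁ ∪ occ C₂ = Set.univ)
    (hP₁ : P₁ ⊆ Set.univ ×ˢ (occ C₁ \ occ C₂))
    (hP₂ : P₂ ⊆ Set.univ ×ˢ (occ C₂ \ occ C₁))
    (hOK₁ : PrioOK P₁) (hOK₂ : PrioOK P₂) (hOK : PrioOK (P₁ ∪ P₂)) :
    Lang (⟨ι₁ ⊕ ι₂, Sum.elim C₁ C₂, P₁ ∪ P₂⟩ : System A) ⊆
      Lang (⟨ι₁ ⊕ Unit, Sum.elim C₁ fun _ => stutter (occ C₂ \ occ C₁), P₁⟩ : System A) ∩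
      Lang (⟨Unit ⊕ ι₂, Sum.elim (fun _ => stutter (occ C₁ \ occ C₂)) C₂, P₂⟩ : System A) := by
  exact Set.subset_inter
    (lang_subset_stutter_right C₁ C₂ _ Set.subset_union_left fun _ hp => (hP₁ hp).2.2)
    ((lang_subset_swap C₁ C₂ _).trans <|
      (lang_subset_stutter_right C₂ C₁ _ Set.subset_union_right fun _ hp => (hP₂ hp).2.2).trans
        (lang_subset_swap _ _ _))
end

section
/- Let C_1 and C_2 be two disjoint sets of components over alphabet Σ, with Σ partitioned into Σ_12 (labels occurring in both C_1 and C_2), Σ_1 (labels occurring only in C_1), and Σ_2 (labels occurring only in C_2), and let P_1 ⊆ Σ × Σ_1 and P_2 ⊆ Σ × Σ_2. If an interaction σ ∈ Σ is enabled in a configuration c of the system S_{1+2} = (C_1 ∪ C_2, Σ, P_1 ∪ P_2), then σ is also enabled in the configuration of S_1 = (C_1 ∪ {d_1}, Σ, P_1) obtained from c by keeping the locations and valuations of the components of C_1 and placing d_1 in its unique location. -/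
open scoped Classical

open BIP

/-- if an interaction `σ` is enabled in a configuration `c` of
`S_{1+2} = (C₁ ∪ C₂, Σ, P₁ ∪ P₂)`, then `σ` is also enabled in the
configuration of `S₁ = (C₁ ∪ {d₁}, Σ, P₁)` obtained from `c` by keeping the
states of the components of `C₁` and placing `d₁` in its unique location. -/
theorem enabled_in_sub_of_enabled {A : Type} [Fintype A] {ι₁ ι₂ : Type} [Finite ι₁] [Finite ι₂]
    (C₁ : ι₁ → Component A) (C₂ : ι₂ → Component A) (P₁ P₂ : Set (A × A))
    (hcov : occ C₁ ∪ occ C₂ = Set.univ)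
    (hP₁ : P₁ ⊆ Set.univ ×ˢ (occ C₁ \ occ C₂))
    (hP₂ : P₂ ⊆ Set.univ ×ˢ (occ C₂ \ occ C₁))
    (hOK₁ : PrioOK P₁) (hOK₂ : PrioOK P₂) (hOK : PrioOK (P₁ ∪ P₂))
    (σ : A) (c : Config (⟨ι₁ ⊕ ι₂, Sum.elim C₁ C₂, P₁ ∪ P₂⟩ : System A))
    (h : Enabled (⟨ι₁ ⊕ ι₂, Sum.elim C₁ C₂, P₁ ∪ P₂⟩ : System A) σ c) :
    Enabled (⟨ι₁ ⊕ Unit, Sum.elim C₁ fun _ => stutter (occ C₂ \ occ C₁), P₁⟩ : System A) σ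
      (fun i => match i with
        | Sum.inl j => c (Sum.inl j)
        | Sum.inr _ => ((), fun v => v.elim)) := by
  refine ⟨?_, fun τ hτ hjoint => h.2 τ (Or.inl hτ) ?_⟩
  · rintro (i | _) hσ
    · exact h.1 (Sum.inl i) hσ
    · exact ⟨_, ⟨σ, hσ, rfl⟩, rfl, rfl, rfl⟩
  · rintro (i | j) hmem
    · exact hjoint (Sum.inl i) hmem
    · exact absurd (Set.mem_iUnion.2 ⟨j, hmem⟩) (hP₁ hτ).2.2
end

section
/- (Soundness of the assume-guarantee rule) Let S = (C_1 ∪ C_2, Σ, P) be a simple BIP system with Σ partitioned into Σ_12, Σ_1, Σ_2 and P ⊆ Σ × (Σ_1 ∪ Σ_2). Let P_1 ⊆ Σ × Σ_1 and P_2 ⊆ Σ × Σ_2 be non-conflicting priority sets, let A and R be deterministic finite automata over Σ (the assumption and the risk specification), and set S_{1+} = (C_1 ∪ {d_1}, Σ, (P ∩ Σ × Σ_1) ∪ P_1) and S_{2+} = (C_2 ∪ {d_2}, Σ, (P ∩ Σ × Σ_2) ∪ P_2). If L(S_{1+}) ∩ L(R) ∩ L(A) = ∅ and L(S_{2+}) ∩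 (Σ* \ L(A)) = ∅, then L(S_+) ∩ L(R) = ∅ for S_+ = (C_1 ∪ C_2, Σ, P ∪ P_1 ∪ P_2); i.e., the priority set P_1 ∪ P_2 makes S B-safe with respect to L(R). -/
open scoped Classical

open BIP

namespace BIP

theorem Run.map {A : Type} {S T : System A} (f : Config S → Config T)
    (hf : ∀ σ c c', Step S σ c c' → Step T σ (f c) (f c'))
    {c c' : Config S} {w : List A} (h : Run S c w c') : Run T (f c) w (f c') := by
  induction h with
  | nil c => exact .nil _
  | cons hs _ ih => exact .cons (hf _ _ _ hs) ih

theorem lang_subset_of_simulation {A : Type} {S T : System A} (f : Config S → Config T)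
    (hinit : f (initConfig S) = initConfig T)
    (hf : ∀ σ c c', Step S σ c c' → Step T σ (f c) (f c')) : Lang S ⊆ Lang T := by
  rintro w ⟨c', h⟩
  exact ⟨f c', hinit ▸ h.map f hf⟩

theorem exists_stutter_trans {A : Type} {Sl : Set A} {σ : A} (hσ : σ ∈ Sl)
    (s s' : (stutter Sl).Loc × ((stutter Sl).Var → Bool)) :
    ∃ t ∈ (stutter Sl).trans, t.label = σ ∧ t.src = s.1 ∧ t.guard s.2 = true ∧
      s'.1 = t.dst ∧ s'.2 = fun v => t.update v s.2 :=
  ⟨_, ⟨σ, hσ, rfl⟩, rfl, rfl, rfl, rfl, funext fun v => v.elim⟩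

/-- Replacing the right-hand components by a stuttering component over-approximates the language,
provided the remaining priorities dominate only by labels foreign to the right-hand components. -/
theorem lang_sum_subset_left {A ι₁ ι₂ : Type} (C₁ : ι₁ → Component A) (C₂ : ι₂ → Component A)
    (Sl : Set A) {P Q : Set (A × A)} (hPQ : P ⊆ Q) (hP : ∀ p ∈ P, p.2 ∉ occ C₂) :
    Lang (⟨ι₁ ⊕ ι₂, Sum.elim C₁ C₂, Q⟩ : System A) ⊆
      Lang (⟨ι₁ ⊕ Unit, Sum.elim C₁ fun _ => stutter Sl, P⟩ : System A) := by
  refine lang_subset_of_simulation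
    (fun c => Sum.rec (fun i => c (.inl i)) fun _ => ((), fun v => v.elim)) ?_ ?_
  · funext i
    rcases i with i | i <;> rfl
  · rintro σ c c' ⟨⟨hjoint, hmax⟩, hmove⟩
    refine ⟨⟨?_, fun σ' hσ' hjoint' => hmax σ' (hPQ hσ') ?_⟩, ?_⟩
    · rintro (i | i) hi
      · exact hjoint (.inl i) hi
      · exact ⟨_, ⟨σ, hi, rfl⟩, rfl, rfl, rfl⟩
    · rintro (i | i) hi
      · exact hjoint' (.inl i) hi
      · exact absurd (Set.mem_iUnion.2 ⟨i, hi⟩) (hP _ hσ')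
    · rintro (i | i)
      · exact hmove (.inl i)
      · exact ⟨fun hi => exists_stutter_trans hi _ _, fun _ => rfl⟩

theorem lang_sum_swap {A ι₁ ι₂ : Type} (C₁ : ι₁ → Component A) (C₂ : ι₂ → Component A)
    (P : Set (A × A)) :
    Lang (⟨ι₁ ⊕ ι₂, Sum.elim C₁ C₂, P⟩ : System A) ⊆
      Lang (⟨ι₂ ⊕ ι₁, Sum.elim C₂ C₁, P⟩ : System A) := by
  refine lang_subset_of_simulation
    (fun c => Sum.rec (fun i => c (.inr i)) fun i => c (.inl i)) ?_ ?_
  · funext i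
    rcases i with i | i <;> rfl
  · rintro σ c c' ⟨⟨hjoint, hmax⟩, hmove⟩
    refine ⟨⟨?_, fun σ' hσ' hjoint' => hmax σ' hσ' ?_⟩, ?_⟩
    · rintro (i | i)
      exacts [hjoint (.inr i), hjoint (.inl i)]
    · rintro (i | i)
      exacts [hjoint' (.inr i), hjoint' (.inl i)]
    · rintro (i | i)
      exacts [hmove (.inr i), hmove (.inl i)]

end BIP

/-- Soundness of the assume-guarantee rule: if
`L(S_{1+}) ∩ L(R) ∩ L(A) = ∅` and `L(S_{2+}) ∩ (Σ* \ L(A)) = ∅`, where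
`S_{i+} = (C_i ∪ {d_i}, Σ, (P ∩ Σ×Σ_i) ∪ P_i)`, `P ⊆ Σ × (Σ₁ ∪ Σ₂)`, the
priority sets `P₁ ⊆ Σ×Σ₁` and `P₂ ⊆ Σ×Σ₂` are non-conflicting, then
`L(S_+) ∩ L(R) = ∅` for `S_+ = (C₁ ∪ C₂, Σ, P ∪ P₁ ∪ P₂)`. -/
theorem assume_guarantee_sound {A : Type} [Fintype A] {ι₁ ι₂ : Type} [Finite ι₁] [Finite ι₂]
    (C₁ : ι₁ → Component A) (C₂ : ι₂ → Component A) (P P₁ P₂ : Set (A × A))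
    {QA QR : Type} (Adfa : DFA A QA) (R : DFA A QR)
    (hcov : occ C₁ ∪ occ C₂ = Set.univ)
    (hP : P ⊆ Set.univ ×ˢ ((occ C₁ \ occ C₂) ∪ (occ C₂ \ occ C₁)))
    (hP₁ : P₁ ⊆ Set.univ ×ˢ (occ C₁ \ occ C₂))
    (hP₂ : P₂ ⊆ Set.univ ×ˢ (occ C₂ \ occ C₁))
    (hPOK : PrioOK P) (hNonConflicting : PrioOK (P₁ ∪ P₂))
    (h1 : Lang (⟨ι₁ ⊕ Unit, Sum.elim C₁ fun _ => stutter (occ C₂ \ occ C₁),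
            {p ∈ P | p.2 ∈ occ C₁ \ occ C₂} ∪ P₁⟩ : System A) ∩
          (R.accepts : Set (List A)) ∩ (Adfa.accepts : Set (List A)) = ∅)
    (h2 : Lang (⟨Unit ⊕ ι₂, Sum.elim (fun _ => stutter (occ C₁ \ occ C₂)) C₂,
            {p ∈ P | p.2 ∈ occ C₂ \ occ C₁} ∪ P₂⟩ : System A) ∩
          (Adfa.accepts : Set (List A))ᶜ = ∅) :
    Lang (⟨ι₁ ⊕ ι₂, Sum.elim C₁ C₂, P ∪ P₁ ∪ P₂⟩ : System A) ∩
      (R.accepts : Set (List A)) = ∅ := by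
  have hpre₁ : {p ∈ P | p.2 ∈ occ C₁ \ occ C₂} ∪ P₁ ⊆ P ∪ P₁ ∪ P₂ := by
    rintro p (⟨hp, -⟩ | hp)
    exacts [.inl (.inl hp), .inl (.inr hp)]
  have hpre₂ : {p ∈ P | p.2 ∈ occ C₂ \ occ C₁} ∪ P₂ ⊆ P ∪ P₁ ∪ P₂ := by
    rintro p (⟨hp, -⟩ | hp)
    exacts [.inl (.inl hp), .inr hp]
  refine Set.eq_empty_iff_forall_notMem.2 fun w ⟨hw, hR⟩ => ?_
  have hw₁ := lang_sum_subset_left C₁ C₂ (occ C₂ \ occ C₁) hpre₁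
    (by rintro p (⟨-, hp⟩ | hp); exacts [hp.2, (hP₁ hp).2.2]) hw
  have hw₂ := lang_sum_swap _ _ _ <|
    lang_sum_subset_left C₂ C₁ (occ C₁ \ occ C₂) hpre₂
      (by rintro p (⟨-, hp⟩ | hp); exacts [hp.2, (hP₂ hp).2.2]) (lang_sum_swap _ _ _ hw)
  by_cases hA : w ∈ (Adfa.accepts : Set (List A))
  · exact Set.eq_empty_iff_forall_notMem.1 h1 w ⟨⟨hw₁, hR⟩, hA⟩
  · exact Set.eq_empty_iff_forall_notMem.1 h2 w ⟨hw₂, hA⟩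
end

section
/- The restriction that no shared interaction has higher priority than other interactions is necessary for the Composition Lemma: there exist an alphabet Σ = {a, b, c}, single components C_1 and C_2 with Σ_12 = {a, b}, Σ_1 = ∅, Σ_2 = {c}, and a priority set P = {(b, a)} (which is not contained in Σ × (Σ_1 ∪ Σ_2)), such that the one-letter word b belongs to L((C_1 ∪ C_2, Σ, P)) but b does not belong to L((C_1 ∪ {d_1}, Σ, P)); hence L((C_1 ∪ C_2, Σ, P)) is not contained in L((C_1 ∪ {d_1}, Σ, P)) ∩ L((C_2 ∪ {d_2}, Σ, P)). -/
open scoped Classical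

open BIP

namespace BIP

/-- The component `stutter Sl` with only the self-loops labelled in `En` retained. -/
def partialStutter {A : Type} (Sl En : Set A) : Component A :=
  { stutter Sl with trans := (stutter En).trans }

theorem exists_mem_stutter_trans {A : Type} {En : Set A} {σ : A} (hσ : σ ∈ En)
    (s : Unit × (Empty → Bool)) :
    ∃ t ∈ (stutter En).trans, t.label = σ ∧ t.src = s.1 ∧ t.guard s.2 = true ∧
      s.1 = t.dst ∧ s.2 = fun v => t.update v s.2 :=
  ⟨_, ⟨σ, hσ, rfl⟩, rfl, rfl, rfl, rfl, funext fun v => v.elim⟩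

theorem label_mem_of_mem_stutter_trans {A : Type} {En : Set A}
    {t : BTrans A (stutter En).Loc (stutter En).Var} (ht : t ∈ (stutter En).trans) :
    t.label ∈ En := by
  obtain ⟨a, ha, rfl⟩ := ht
  exact ha

theorem singleton_mem_lang {A : Type} {S : System A} {σ : A} :
    [σ] ∈ Lang S ↔ ∃ c, Step S σ (initConfig S) c := by
  constructor
  · rintro ⟨_, _ | ⟨h, _⟩⟩
    exact ⟨_, h⟩
  · rintro ⟨c, h⟩
    exact ⟨c, .cons h (.nil c)⟩

theorem prioOK_singleton {A : Type} {a b : A} (h : a ≠ b) : PrioOK {(a, b)} := by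
  constructor
  · simp only [Set.mem_singleton_iff, Prod.mk.injEq]
    rintro _ _ _ ⟨rfl, rfl⟩ ⟨rfl, _⟩
    exact absurd rfl h
  · simp only [Set.mem_singleton_iff, Prod.mk.injEq]
    rintro _ ⟨rfl, rfl⟩
    exact h rfl

end BIP

/-- the restriction that no shared interaction has higher priority
is necessary for the Composition Lemma.  With `a = 0`, `b = 1`, `c = 2` there
are single components `C₁` (with alphabet `Σ₁₂ = {a, b}`, so `Σ₁ = ∅`) and
`C₂` (with alphabet `{a, b, c}`, so `Σ₂ = {c}`) and the priority set
`P = {(b, a)}` (not contained in `Σ × (Σ₁ ∪ Σ₂)`) such that the word `b`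
belongs to `L((C₁ ∪ C₂, Σ, P))` but not to `L((C₁ ∪ {d₁}, Σ, P))`; hence
`L((C₁ ∪ C₂, Σ, P))` is not contained in
`L((C₁ ∪ {d₁}, Σ, P)) ∩ L((C₂ ∪ {d₂}, Σ, P))`. -/
theorem shared_priority_counterexample :
    ∃ (C₁ C₂ : Component (Fin 3)) (P : Set (Fin 3 × Fin 3)),
      C₁.alph = {0, 1} ∧ C₂.alph = {0, 1, 2} ∧ P = {((1 : Fin 3), (0 : Fin 3))} ∧
      PrioOK P ∧
      [(1 : Fin 3)] ∈
        Lang (⟨Unit ⊕ Unit, Sum.elim (fun _ => C₁) fun _ => C₂, P⟩ : System (Fin 3)) ∧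
      [(1 : Fin 3)] ∉
        Lang (⟨Unit ⊕ Unit, Sum.elim (fun _ => C₁) fun _ => stutter {2},
          P⟩ : System (Fin 3)) ∧
      ¬ (Lang (⟨Unit ⊕ Unit, Sum.elim (fun _ => C₁) fun _ => C₂, P⟩ : System (Fin 3)) ⊆
          Lang (⟨Unit ⊕ Unit, Sum.elim (fun _ => C₁) fun _ => stutter {2},
            P⟩ : System (Fin 3)) ∩
          Lang (⟨Unit ⊕ Unit, Sum.elim (fun _ => stutter (∅ : Set (Fin 3))) fun _ => C₂,
            P⟩ : System (Fin 3))) := by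
  have hpos : [(1 : Fin 3)] ∈ Lang (⟨Unit ⊕ Unit, Sum.elim (fun _ => stutter {0, 1})
      fun _ => partialStutter {0, 1, 2} {1, 2}, {(1, 0)}⟩ : System (Fin 3)) := by
    refine singleton_mem_lang.2 ⟨initConfig _, ⟨?_, ?_⟩, ?_⟩
    · rintro (_ | _) _
      · obtain ⟨t, ht, h₁, h₂, h₃, -⟩ := exists_mem_stutter_trans
          (En := {(0 : Fin 3), 1}) (σ := 1) (by simp) ((), fun v => v.elim)
        exact ⟨t, ht, h₁, h₂, h₃⟩
      · obtain ⟨t, ht, h₁, h₂, h₃, -⟩ := exists_mem_stutter_trans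
          (En := {(1 : Fin 3), 2}) (σ := 1) (by simp) ((), fun v => v.elim)
        exact ⟨t, ht, h₁, h₂, h₃⟩
    · rintro σ' hσ' hJ
      obtain rfl : σ' = 0 := (Prod.mk.inj hσ').2
      obtain ⟨t, ht, hl, -⟩ := hJ (.inr ()) (Set.mem_insert _ _)
      have : (0 : Fin 3) ∈ ({1, 2} : Set (Fin 3)) :=
        hl ▸ label_mem_of_mem_stutter_trans (En := {1, 2}) ht
      simp at this
    · rintro (_ | _)
      · exact ⟨fun _ => exists_mem_stutter_trans (En := {0, 1}) (by simp) _, fun _ => rfl⟩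
      · exact ⟨fun _ => exists_mem_stutter_trans (En := {1, 2}) (by simp) _, fun _ => rfl⟩
  have hneg : [(1 : Fin 3)] ∉ Lang (⟨Unit ⊕ Unit, Sum.elim (fun _ => stutter {0, 1})
      fun _ => stutter {2}, {(1, 0)}⟩ : System (Fin 3)) := by
    rw [singleton_mem_lang]
    rintro ⟨_, ⟨_, h⟩, _⟩
    refine h 0 rfl ?_
    rintro (_ | _) hmem
    · obtain ⟨t, ht, h₁, h₂, h₃, -⟩ := exists_mem_stutter_trans
        (En := {(0 : Fin 3), 1}) (σ := 0) (by simp) ((), fun v => v.elim)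
      exact ⟨t, ht, h₁, h₂, h₃⟩
    · exact absurd (show (0 : Fin 3) ∈ ({2} : Set (Fin 3)) from hmem) (by simp)
  exact ⟨stutter {0, 1}, partialStutter {0, 1, 2} {1, 2}, {(1, 0)}, rfl, rfl, rfl,
    prioOK_singleton (by decide), hpos, hneg, fun h => hneg (h hpos).1⟩
end

section
/- Deadlock-freedom is not preserved by component-wise approximation: there exist simple BIP systems over the alphabet Σ = {a, b} with empty priority set, namely S = (C_1 ∪ C_2, Σ, ∅), S^α = (C_1^α ∪ C_2, Σ, ∅), and S^β = (C_1^β ∪ C_2, Σ, ∅), where every trace of the standalone component C_1 is a trace of C_1^α (over-approximation) and every trace of C_1^β is a trace of C_1 (under-approximation), such that S has a reachable deadlock configuration while both S^α and S^β are deadlock-free. -/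
open scoped Classical

open BIP

namespace BIP

/-- The unguarded transition over an empty set of variables. -/
def plainTrans {A L : Type} (l : L) (a : A) (l' : L) : BTrans A L Empty :=
  ⟨l, fun _ => true, a, fun v _ => v.elim, l'⟩

/-- The one-location component over the full alphabet with a self-loop for every label in `Sl`. -/
def selfLoops {A : Type} (Sl : Set A) : Component A :=
  { stutter Sl with alph := Set.univ }

/-- The component over the full alphabet that loops on `a` until it executes `b`, after which it
has no transitions. -/
def loopThenStop {A : Type} (a b : A) : Component A where
  Loc := Bool
  Var := Empty
  alph := Set.univ
  trans := {plainTrans false a false, plainTrans false b true}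
  initLoc := false
  initVal := fun v => v.elim

theorem traces_selfLoops_univ {A : Type} : Traces (selfLoops (Set.univ : Set A)) = Set.univ := by
  refine Set.eq_univ_of_forall fun w => ?_
  suffices h : ∀ e, CompTrace (selfLoops (Set.univ : Set A)) () e w from h _
  induction w with
  | nil => exact fun e => .nil () e
  | cons a w ih =>
    exact fun e => .cons (co := selfLoops Set.univ) (plainTrans () a ()) ⟨a, trivial, rfl⟩ rfl rfl
      (ih _)

theorem traces_selfLoops_singleton_subset {A : Type} (a b : A) :
    Traces (selfLoops {a}) ⊆ Traces (loopThenStop a b) := by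
  suffices h : ∀ l e w, CompTrace (selfLoops {a}) l e w →
      ∀ e', CompTrace (loopThenStop a b) false e' w from fun w hw => h _ _ w hw _
  intro l e w h
  induction h with
  | nil => exact fun e' => .nil (co := loopThenStop a b) false e'
  | cons t ht _ _ _ ih =>
    obtain ⟨x, rfl, rfl⟩ := ht
    exact fun e' => .cons (co := loopThenStop x b) (plainTrans false x false) (Or.inl rfl) rfl rfl
      (ih _)

/-- A system without priorities is deadlock-free if some label has an unguarded self-loop at every
location of every component. -/
theorem deadlockFree_of_forall_selfLoops {A : Type} {S : System A} (hP : S.prio = ∅) (a : A)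
    (h : ∀ i, ∃ Sl : Set A, a ∈ Sl ∧ S.comp i = selfLoops Sl) : DeadlockFree S := by
  intro c _ hd
  refine hd a ⟨fun i _ => ?_, fun σ' hσ' => by simp [hP] at hσ'⟩
  obtain ⟨Sl, ha, hS⟩ := h i
  generalize c i = s
  revert s
  rw [hS]
  exact fun s => ⟨plainTrans () a (), ⟨a, ha, rfl⟩, rfl, rfl, rfl⟩

/-- After executing `b`, a `loopThenStop` component blocks every interaction. -/
theorem exists_reachable_deadlock_loopThenStop {A : Type} (a b : A) :
    ∃ c ∈ Reach (⟨Unit ⊕ Unit, Sum.elim (fun _ => loopThenStop a b)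
          fun _ => selfLoops Set.univ, ∅⟩ : System A),
      Deadlock (⟨Unit ⊕ Unit, Sum.elim (fun _ => loopThenStop a b)
          fun _ => selfLoops Set.univ, ∅⟩ : System A) c := by
  refine ⟨Sum.rec (fun _ => (true, fun v => v.elim)) fun _ => ((), fun v => v.elim),
    .single ⟨b, ⟨?_, fun _ h => h.elim⟩, ?_⟩, ?_⟩
  · rintro (_ | _) _
    · exact ⟨plainTrans false b true, Or.inr rfl, rfl, rfl, rfl⟩
    · exact ⟨plainTrans () b (), ⟨b, trivial, rfl⟩, rfl, rfl, rfl⟩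
  · rintro (_ | _)
    · exact ⟨fun _ => ⟨plainTrans false b true, Or.inr rfl, rfl, rfl, rfl, rfl,
        funext fun v => v.elim⟩, fun h => (h trivial).elim⟩
    · exact ⟨fun _ => ⟨plainTrans () b (), ⟨b, trivial, rfl⟩, rfl, rfl, rfl, rfl,
        funext fun v => v.elim⟩, fun h => (h trivial).elim⟩
  · rintro σ ⟨hσ, -⟩
    obtain ⟨t, ht, -, hsrc, -⟩ := hσ (Sum.inl ()) trivial
    rcases ht with rfl | rfl <;> exact Bool.false_ne_true hsrc

end BIP

/-- deadlock-freedom is not preserved by component-wise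
approximation.  There are components `C₁`, an over-approximation `C₁ᵃ`
(`Traces C₁ ⊆ Traces C₁ᵃ`), an under-approximation `C₁ᵇ`
(`Traces C₁ᵇ ⊆ Traces C₁`), and `C₂`, over the two-letter alphabet with empty
priority set, such that `S = (C₁ ∪ C₂, Σ, ∅)` has a reachable deadlock
configuration while both `Sᵃ = (C₁ᵃ ∪ C₂, Σ, ∅)` and `Sᵇ = (C₁ᵇ ∪ C₂, Σ, ∅)`
are deadlock-free. -/
theorem abstraction_not_deadlock_preserving :
    ∃ C₁ C₁a C₁b C₂ : Component (Fin 2),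
      Traces C₁ ⊆ Traces C₁a ∧ Traces C₁b ⊆ Traces C₁ ∧
      (∃ c ∈ Reach (⟨Unit ⊕ Unit, Sum.elim (fun _ => C₁) fun _ => C₂,
            ∅⟩ : System (Fin 2)),
        Deadlock (⟨Unit ⊕ Unit, Sum.elim (fun _ => C₁) fun _ => C₂,
            ∅⟩ : System (Fin 2)) c) ∧
      DeadlockFree (⟨Unit ⊕ Unit, Sum.elim (fun _ => C₁a) fun _ => C₂,
          ∅⟩ : System (Fin 2)) ∧
      DeadlockFree (⟨Unit ⊕ Unit, Sum.elim (fun _ => C₁b) fun _ => C₂,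
          ∅⟩ : System (Fin 2)) := by
  refine ⟨loopThenStop 0 1, selfLoops Set.univ, selfLoops {0}, selfLoops Set.univ,
    traces_selfLoops_univ ▸ Set.subset_univ _, traces_selfLoops_singleton_subset 0 1,
    exists_reachable_deadlock_loopThenStop 0 1,
    deadlockFree_of_forall_selfLoops rfl 0 ?_, deadlockFree_of_forall_selfLoops rfl 0 ?_⟩
  · rintro (_ | _) <;> exact ⟨Set.univ, trivial, rfl⟩
  · rintro (_ | _)
    · exact ⟨{0}, rfl, rfl⟩
    · exact ⟨Set.univ, trivial, rfl⟩
end
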